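/- arXiv:2512.18975 — 4 statements merged into one kernel-verified Lean document; each statement's English description precedes it below -/
import Mathlib

section
/- Let n ≥ 5 and let d be a metric on V_n. If for every nontrivial cut C ⊆ V_n (i.e. ∅ ⊊ C ⊊ V_n) the inequality s_C ≥ (|C|·(n − |C|) / (C(n,2) + 1)) · Tr(d) holds, then d lies in the cut cone CUT_n. -/
open Finset

/-- A metric on a finite set: zero on the diagonal, symmetric, positive off the
diagonal, and satisfying the triangle inequality. -/
def IsMetric {α : Type*} (d : α → α → ℝ) : Prop :=
  (∀ i, d i i = 0) ∧ (∀ i j, d i j = d j i) ∧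
  (∀ i j, i ≠ j → 0 < d i j) ∧ (∀ i j k, d i j ≤ d i k + d k j)

/-- The cut semimetric `δ_C`: equals 1 iff exactly one of `i, j` lies in `C`. -/
def cutSemimetric {α : Type*} [DecidableEq α] (C : Finset α) (i j : α) : ℝ :=
  if (i ∈ C ∧ j ∉ C) ∨ (j ∈ C ∧ i ∉ C) then 1 else 0

/-- Membership in the pair-cut cone `PCUT_n`: `d` is a nonnegative linear combination
of the cut semimetrics of 2-element cuts. -/
def InPCUT {n : ℕ} (d : Fin n → Fin n → ℝ) : Prop :=
  ∃ w : Finset (Fin n) → ℝ, (∀ P, 0 ≤ w P) ∧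
    ∀ i j, d i j = ∑ P ∈ Finset.powersetCard 2 (Finset.univ : Finset (Fin n)),
      w P * cutSemimetric P i j

/-- The trace `Tr(d) = ∑_{i<j} d(i,j)`. -/
def traceMetric {n : ℕ} (d : Fin n → Fin n → ℝ) : ℝ :=
  ∑ i : Fin n, ∑ j ∈ Finset.univ.filter (fun j => i < j), d i j

/-- The star trace `s_i = ∑_{j ≠ i} d(i,j)`. -/
def starTrace {n : ℕ} (d : Fin n → Fin n → ℝ) (i : Fin n) : ℝ :=
  ∑ j ∈ Finset.univ.erase i, d i j


/-- Membership in the cut cone `CUT_n`: `d` is a nonnegative linear combination of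
cut semimetrics, indexed by all subsets `C ⊆ V_n`. -/
def InCUT {n : ℕ} (d : Fin n → Fin n → ℝ) : Prop :=
  ∃ w : Finset (Fin n) → ℝ, (∀ C, 0 ≤ w C) ∧
    ∀ i j, d i j = ∑ C : Finset (Fin n), w C * cutSemimetric C i j

/-- The `C`-trace `s_C = ∑_{i ∈ C, j ∉ C} d(i,j)`. -/
def cutTrace {n : ℕ} (d : Fin n → Fin n → ℝ) (C : Finset (Fin n)) : ℝ :=
  ∑ i ∈ C, ∑ j ∈ Cᶜ, d i j

lemma cutSemimetric_self {α : Type*} [DecidableEq α] (C : Finset α) (i : α) :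
    cutSemimetric C i i = 0 := by
  simp [cutSemimetric]

lemma cutSemimetric_comm {α : Type*} [DecidableEq α] (C : Finset α) (i j : α) :
    cutSemimetric C i j = cutSemimetric C j i := by
  simp only [cutSemimetric, or_comm]

lemma cutSemimetric_symmDiff_singleton {α : Type*} [DecidableEq α] (C : Finset α) {k l : α}
    (hkl : k ≠ l) : cutSemimetric (symmDiff C {k}) k l = 1 - cutSemimetric C k l := by
  by_cases hk : k ∈ C <;> by_cases hl : l ∈ C <;>
    simp [cutSemimetric, mem_symmDiff, hk, hl, hkl.symm]

lemma cutSemimetric_symmDiff_singleton_of_ne {α : Type*} [DecidableEq α] (C : Finset α)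
    {k i j : α} (hi : i ≠ k) (hj : j ≠ k) :
    cutSemimetric (symmDiff C {k}) i j = cutSemimetric C i j := by
  simp [cutSemimetric, mem_symmDiff, hi, hj]

section Fintype

variable {α : Type*} [Fintype α] [DecidableEq α]

lemma sum_symmDiff_singleton (F : Finset α → ℝ) (k : α) :
    ∑ C, F (symmDiff C {k}) = ∑ C, F C :=
  Equiv.sum_comp (Function.Involutive.toPerm (fun C : Finset α => symmDiff C {k})
    (fun C => symmDiff_symmDiff_cancel_right {k} C)) F

lemma two_mul_sum_cutSemimetric {i j : α} (hij : i ≠ j) :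
    2 * ∑ C, cutSemimetric C i j = 2 ^ Fintype.card α := by
  have h := sum_symmDiff_singleton (fun C => cutSemimetric C i j) i
  simp only [cutSemimetric_symmDiff_singleton _ hij, sum_sub_distrib, sum_const, card_univ,
    Fintype.card_finset, nsmul_eq_mul, mul_one] at h
  push_cast at h
  linarith

lemma four_mul_sum_cutSemimetric_mul_of_ne {i j k l : α} (hij : i ≠ j) (hkl : k ≠ l)
    (hi : i ≠ k) (hj : j ≠ k) :
    4 * ∑ C, cutSemimetric C k l * cutSemimetric C i j = 2 ^ Fintype.card α := by
  have h := sum_symmDiff_singleton (fun C => cutSemimetric C k l * cutSemimetric C i j) k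
  simp only [cutSemimetric_symmDiff_singleton _ hkl,
    cutSemimetric_symmDiff_singleton_of_ne _ hi hj, sub_mul, one_mul, sum_sub_distrib] at h
  linarith [two_mul_sum_cutSemimetric hij]

lemma four_mul_sum_cutSemimetric_mul {i j k l : α} (hij : i ≠ j) (hkl : k ≠ l) :
    4 * ∑ C, cutSemimetric C k l * cutSemimetric C i j =
      2 ^ Fintype.card α *
        (1 + (if k = i ∧ l = j then 1 else 0) + (if k = j ∧ l = i then 1 else 0)) := by
  have hsq (C : Finset α) :
      cutSemimetric C i j * cutSemimetric C i j = cutSemimetric C i j := by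
    unfold cutSemimetric
    split_ifs <;> simp
  by_cases h₁ : k = i ∧ l = j
  · obtain ⟨rfl, rfl⟩ := h₁
    simp only [hsq, and_self, if_true, hij, false_and, if_false]
    linarith [two_mul_sum_cutSemimetric hij]
  by_cases h₂ : k = j ∧ l = i
  · obtain ⟨rfl, rfl⟩ := h₂
    simp only [cutSemimetric_comm _ k l, hsq, and_self, if_true, hkl, false_and, if_false]
    linarith [two_mul_sum_cutSemimetric hij]
  simp only [h₁, h₂, if_false, add_zero, mul_one]
  by_cases hk : i ≠ k ∧ j ≠ k
  · exact four_mul_sum_cutSemimetric_mul_of_ne hij hkl hk.1 hk.2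
  · simp only [cutSemimetric_comm _ k l]
    apply four_mul_sum_cutSemimetric_mul_of_ne hij hkl.symm <;> grind

end Fintype

section Trace

variable {n : ℕ} {g : Fin n → Fin n → ℝ}

lemma two_mul_traceMetric (h₀ : ∀ i, g i i = 0) (hs : ∀ i j, g i j = g j i) :
    2 * traceMetric g = ∑ i, ∑ j, g i j := by
  have h (i j : Fin n) : g i j = (if i < j then g i j else 0) + (if j < i then g j i else 0) := by
    rcases lt_trichotomy i j with h | rfl | h
    · simp [h, h.not_gt]
    · simp [h₀]
    · simp [h, h.not_gt, hs i j]
  have h' : ∑ i, ∑ j, g i j =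
      ∑ i, ∑ j, (if i < j then g i j else 0) + ∑ i, ∑ j, (if j < i then g j i else 0) := by
    simp only [← sum_add_distrib, ← h]
  rw [h', sum_comm (f := fun i j => if j < i then g j i else 0)]
  simp only [traceMetric, sum_filter]
  ring

lemma two_mul_cutTrace (hs : ∀ i j, g i j = g j i) (C : Finset (Fin n)) :
    2 * cutTrace g C = ∑ i, ∑ j, g i j * cutSemimetric C i j := by
  have h (i j : Fin n) : g i j * cutSemimetric C i j =
      (if i ∈ C then if j ∈ Cᶜ then g i j else 0 else 0) +
        (if j ∈ C then if i ∈ Cᶜ then g j i else 0 else 0) := by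
    by_cases hi : i ∈ C <;> by_cases hj : j ∈ C <;> simp [cutSemimetric, hi, hj, hs i j]
  have hc : cutTrace g C = ∑ i, ∑ j, if i ∈ C then if j ∈ Cᶜ then g i j else 0 else 0 := by
    simp only [cutTrace, sum_ite_irrel, sum_const_zero, sum_ite_mem, univ_inter]
  simp only [h, sum_add_distrib]
  rw [sum_comm (f := fun i j => if j ∈ C then if i ∈ Cᶜ then g j i else 0 else 0), ← hc]
  ring

/-- Inversion formula recovering a symmetric function from its cut traces. -/
lemma four_mul_sum_cutTrace_mul_cutSemimetric (h₀ : ∀ i, g i i = 0) (hs : ∀ i j, g i j = g j i)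
    {i j : Fin n} (hij : i ≠ j) :
    4 * ∑ C, cutTrace g C * cutSemimetric C i j = 2 ^ n * (g i j + traceMetric g) := by
  have hterm (k l : Fin n) : g k l * (4 * ∑ C, cutSemimetric C k l * cutSemimetric C i j) =
      2 ^ n * (g k l + (if k = i then if l = j then g k l else 0 else 0) +
        (if k = j then if l = i then g k l else 0 else 0)) := by
    by_cases hkl : k = l
    · subst hkl
      simp [h₀]
    · rw [four_mul_sum_cutSemimetric_mul hij hkl, Fintype.card_fin, ← ite_and, ← ite_and]
      split_ifs <;> ring
  have hswap : 2 * (4 * ∑ C, cutTrace g C * cutSemimetric C i j) =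
      ∑ k, ∑ l, g k l * (4 * ∑ C, cutSemimetric C k l * cutSemimetric C i j) := by
    have (C : Finset (Fin n)) : 2 * (4 * (cutTrace g C * cutSemimetric C i j)) =
        ∑ k, ∑ l, g k l * (4 * (cutSemimetric C k l * cutSemimetric C i j)) := by
      rw [show 2 * (4 * (cutTrace g C * cutSemimetric C i j)) =
        (2 * cutTrace g C) * (4 * cutSemimetric C i j) by ring, two_mul_cutTrace hs]
      simp only [sum_mul]
      exact sum_congr rfl fun k _ => sum_congr rfl fun l _ => by ring
    simp only [mul_sum, this]
    rw [sum_comm]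
    exact sum_congr rfl fun k _ => sum_comm
  have hsum : ∑ k, ∑ l, g k l * (4 * ∑ C, cutSemimetric C k l * cutSemimetric C i j) =
      2 ^ n * (2 * traceMetric g + g i j + g j i) := by
    simp only [hterm, ← mul_sum, sum_add_distrib, two_mul_traceMetric h₀ hs, sum_ite_irrel,
      sum_const_zero, sum_ite_eq', mem_univ, if_true]
  rw [hsum, hs j i] at hswap
  linarith

end Trace

lemma cutTrace_discrete {n : ℕ} (C : Finset (Fin n)) :
    cutTrace (fun i j => if i = j then 0 else 1) C = (#C : ℝ) * (n - #C) := by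
  have h : ∀ i ∈ C, ∑ j ∈ Cᶜ, (if i = j then (0 : ℝ) else 1) = n - #C := by
    intro i hi
    rw [sum_congr rfl (g := fun _ => (1 : ℝ)) (by grind [mem_compl]), sum_const, nsmul_one, card_compl,
      Fintype.card_fin, Nat.cast_sub (by simpa using card_le_univ C)]
  rw [cutTrace, sum_congr rfl h, sum_const, nsmul_eq_mul]

lemma traceMetric_discrete (n : ℕ) :
    traceMetric (fun i j : Fin n => if i = j then 0 else 1) = (n.choose 2 : ℝ) := by
  have h : ∀ i : Fin n, ∑ j, (if i = j then (0 : ℝ) else 1) = n - 1 := by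
    intro i
    have (j : Fin n) : (if i = j then (0 : ℝ) else 1) = 1 - if i = j then 1 else 0 := by
      split_ifs <;> simp
    simp [this, sum_sub_distrib]
  have h₂ := two_mul_traceMetric (g := fun i j : Fin n => if i = j then (0 : ℝ) else 1)
    (by simp) (by simp [eq_comm])
  simp only [h, sum_const, card_univ, Fintype.card_fin, nsmul_eq_mul] at h₂
  rw [Nat.cast_choose_two]
  linarith

/-- For `n ≥ 5`, if a metric `d` on `V_n` satisfies
`s_C ≥ (|C|·(n − |C|)/(C(n,2)+1))·Tr(d)` for every nontrivial cut `C`, then `d`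
lies in the cut cone `CUT_n`. -/
theorem cut_cone_membership_of_cutTrace_bound (n : ℕ) (hn : 5 ≤ n)
    (d : Fin n → Fin n → ℝ) (hd : IsMetric d)
    (h : ∀ C : Finset (Fin n), C ≠ ∅ → C ≠ Finset.univ →
      cutTrace d C ≥
        ((C.card : ℝ) * ((n : ℝ) - (C.card : ℝ)) / ((n.choose 2 : ℝ) + 1)) * traceMetric d) :
    InCUT d := by
  obtain ⟨h₀, hs, -, -⟩ := hd
  set c : ℝ := traceMetric d / ((n.choose 2 : ℝ) + 1) with hc
  have hN : (n.choose 2 : ℝ) + 1 ≠ 0 := by positivity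
  refine ⟨fun C => 4 / 2 ^ n * (cutTrace d C - c * ((#C : ℝ) * (n - #C))), fun C => ?_,
    fun i j => ?_⟩
  · refine mul_nonneg (by positivity) (sub_nonneg.2 ?_)
    by_cases hC₀ : C = ∅
    · simp [hC₀, cutTrace]
    by_cases hC₁ : C = univ
    · simp [hC₁, cutTrace]
    · refine le_of_eq_of_le ?_ (h C hC₀ hC₁)
      rw [hc]
      ring
  · rcases eq_or_ne i j with rfl | hij
    · simp [h₀, cutSemimetric_self]
    have hd := four_mul_sum_cutTrace_mul_cutSemimetric h₀ hs hij
    have he := four_mul_sum_cutTrace_mul_cutSemimetric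
      (g := fun i j : Fin n => if i = j then (0 : ℝ) else 1) (by simp) (by simp [eq_comm]) hij
    simp only [cutTrace_discrete, traceMetric_discrete, if_neg hij] at he
    have hsplit : ∑ C : Finset (Fin n),
        4 / 2 ^ n * (cutTrace d C - c * ((#C : ℝ) * (n - #C))) * cutSemimetric C i j =
        (4 * ∑ C, cutTrace d C * cutSemimetric C i j -
          c * (4 * ∑ C : Finset (Fin n), (#C : ℝ) * (n - #C) * cutSemimetric C i j)) / 2 ^ n := by
      simp only [mul_sum, ← sum_sub_distrib, sum_div]
      exact sum_congr rfl fun C _ => by ring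
    rw [hsplit, hd, he, hc]
    field_simp
    ring
end

section
/- Let n ≥ 5 and let d be a metric on V_n whose star trace s_i is independent of i; denote the common value by s. Then d lies in the pair-cut cone PCUT_n if and only if d(i,j) ≤ s/(n − 2) for all pairs of distinct i, j ∈ V_n. -/
open Finset

/-- The total weight of the pairs through `i`, indexed by the other element of the pair. -/
lemma sum_powersetCard_two_ite_mem {α : Type*} [Fintype α] [DecidableEq α]
    (w : Finset α → ℝ) (i : α) :
    ∑ P ∈ powersetCard 2 (univ : Finset α), (if i ∈ P then w P else 0) =
      ∑ k ∈ univ.erase i, w {i, k} := by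
  rw [← sum_filter]
  symm
  refine sum_bij (fun k _ => {i, k}) ?_ ?_ ?_ (fun _ _ => rfl)
  · intro k hk
    have hki : i ≠ k := (ne_of_mem_erase hk).symm
    simp [mem_powersetCard, card_pair hki]
  · intro k hk l hl h
    have hk' : k ∈ ({i, l} : Finset α) := by rw [← h]; simp
    simpa [ne_of_mem_erase hk] using hk'
  · intro P hP
    simp only [mem_filter, mem_powersetCard, subset_univ, true_and] at hP
    obtain ⟨a, b, hab, rfl⟩ := card_eq_two.mp hP.1
    have hi := hP.2
    simp only [mem_insert, mem_singleton] at hi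
    rcases hi with rfl | rfl
    · exact ⟨b, by simp [hab.symm], rfl⟩
    · exact ⟨a, by simp [hab], pair_comm _ _⟩

/-- The only pair containing two distinct points `i` and `j` is `{i, j}`. -/
lemma sum_powersetCard_two_ite_mem_and_mem {α : Type*} [Fintype α] [DecidableEq α]
    (w : Finset α → ℝ) {i j : α} (hij : i ≠ j) :
    ∑ P ∈ powersetCard 2 (univ : Finset α), (if i ∈ P ∧ j ∈ P then w P else 0) =
      w {i, j} := by
  rw [sum_eq_single {i, j}]
  · simp
  · intro P hP hne
    refine if_neg fun h => hne ?_
    refine (eq_of_subset_of_card_le ?_ ?_).symm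
    · simp [insert_subset_iff, h.1, h.2]
    · rw [(mem_powersetCard.mp hP).2, card_pair hij]
  · intro h
    simp [mem_powersetCard, card_pair hij] at h

/-- The distance between distinct points in a combination of pair cuts. -/
lemma sum_mul_cutSemimetric {α : Type*} [Fintype α] [DecidableEq α]
    (w : Finset α → ℝ) {i j : α} (hij : i ≠ j) :
    ∑ P ∈ powersetCard 2 (univ : Finset α), w P * cutSemimetric P i j =
      ∑ k ∈ univ.erase i, w {i, k} + ∑ k ∈ univ.erase j, w {j, k} - 2 * w {i, j} := by
  rw [← sum_powersetCard_two_ite_mem, ← sum_powersetCard_two_ite_mem,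
    ← sum_powersetCard_two_ite_mem_and_mem w hij, mul_sum, ← sum_add_distrib,
    ← sum_sub_distrib]
  refine sum_congr rfl fun P _ => ?_
  by_cases hi : i ∈ P <;> by_cases hj : j ∈ P <;> simp [cutSemimetric, hi, hj]
  ring

/-- The star trace of a combination of pair cuts, in terms of the vertex weights. -/
lemma starTrace_eq_of_pair_weights {n : ℕ} {d : Fin n → Fin n → ℝ} {w : Finset (Fin n) → ℝ}
    (hw : ∀ i j, d i j = ∑ P ∈ powersetCard 2 (univ : Finset (Fin n)),
      w P * cutSemimetric P i j) (i : Fin n) :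
    starTrace d i = ((n : ℝ) - 4) * ∑ k ∈ univ.erase i, w {i, k} +
      ∑ j, ∑ k ∈ univ.erase j, w {j, k} := by
  have hn : 1 ≤ n := i.pos
  have h : starTrace d i = ∑ j ∈ univ.erase i, (∑ k ∈ univ.erase i, w {i, k} +
      ∑ k ∈ univ.erase j, w {j, k} - 2 * w {i, j}) :=
    sum_congr rfl fun j hj => by
      rw [hw, sum_mul_cutSemimetric w (ne_of_mem_erase hj).symm]
  have hsplit := add_sum_erase univ (fun j => ∑ k ∈ univ.erase j, w {j, k}) (mem_univ i)
  rw [h, sum_sub_distrib, sum_add_distrib, ← mul_sum, sum_const,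
    card_erase_of_mem (mem_univ i), card_univ, Fintype.card_fin, nsmul_eq_mul,
    Nat.cast_sub hn, Nat.cast_one]
  linear_combination hsplit

/-- For `n ≥ 5`, a metric `d` on `V_n` whose star trace has a
common value `s` for all vertices lies in the pair-cut cone `PCUT_n` iff
`d(i,j) ≤ s/(n−2)` for all pairs of distinct vertices `i, j`. -/
theorem pcut_membership_iff_of_constant_starTrace (n : ℕ) (hn : 5 ≤ n)
    (d : Fin n → Fin n → ℝ) (hd : IsMetric d) (s : ℝ)
    (hs : ∀ i : Fin n, starTrace d i = s) :
    InPCUT d ↔ ∀ i j : Fin n, i ≠ j → d i j ≤ s / ((n : ℝ) - 2) := by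
  have hn' : (5 : ℝ) ≤ n := by exact_mod_cast hn
  have hn2 : (n : ℝ) - 2 ≠ 0 := by linarith
  constructor
  · rintro ⟨w, hw0, hw⟩ i j hij
    have htrace : ∀ k, s = ((n : ℝ) - 4) * ∑ l ∈ univ.erase k, w {k, l} +
        ∑ j, ∑ l ∈ univ.erase j, w {j, l} := fun k => by
      rw [← hs k, starTrace_eq_of_pair_weights hw]
    have hconst : ∀ k, ∑ l ∈ univ.erase k, w {k, l} = ∑ l ∈ univ.erase i, w {i, l} :=
      fun k => mul_left_cancel₀ (show (n : ℝ) - 4 ≠ 0 by linarith)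
        (by linarith [htrace k, htrace i])
    have hsi := htrace i
    rw [sum_congr rfl fun k _ => hconst k, sum_const, card_univ, Fintype.card_fin,
      nsmul_eq_mul] at hsi
    rw [hw, sum_mul_cutSemimetric w hij, hconst j, le_div_iff₀ (by linarith), hsi]
    nlinarith [mul_nonneg (hw0 {i, j}) (show (0 : ℝ) ≤ n - 2 by linarith)]
  · intro h
    obtain ⟨hdiag, hsymm, -, -⟩ := hd
    let c : ℝ := s / ((n : ℝ) - 2)
    -- The off-diagonal sum counts every ordered pair of a two-element set twice.
    let w : Finset (Fin n) → ℝ := fun P =>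
      max 0 ((c - (∑ p ∈ P.offDiag, d p.1 p.2) / 2) / 2)
    have hw : ∀ i j, i ≠ j → w {i, j} = (c - d i j) / 2 := by
      intro i j hij
      have hoff : ∑ p ∈ ({i, j} : Finset (Fin n)).offDiag, d p.1 p.2 = 2 * d i j := by
        have hne : (i, j) ≠ (j, i) := fun e => hij (congrArg Prod.fst e)
        have : ({i, j} : Finset (Fin n)).offDiag = {(i, j), (j, i)} := by
          ext ⟨a, b⟩
          simp only [mem_offDiag, mem_insert, mem_singleton, Prod.mk.injEq]
          grind
        rw [this, sum_pair hne, hsymm j i]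
        ring
      have hle : d i j ≤ c := h i j hij
      simp only [w, hoff]
      rw [max_eq_right (by linarith)]
      ring
    have hsum : ∀ i, ∑ k ∈ univ.erase i, w {i, k} = c / 2 := by
      intro i
      have hc : c * ((n : ℝ) - 2) = s := div_mul_cancel₀ s hn2
      have hsi : ∑ k ∈ univ.erase i, d i k = s := hs i
      rw [sum_congr rfl fun k hk => hw i k (ne_of_mem_erase hk).symm, ← sum_div,
        sum_sub_distrib, hsi, sum_const, card_erase_of_mem (mem_univ i), card_univ,
        Fintype.card_fin, nsmul_eq_mul, Nat.cast_sub (by omega), Nat.cast_one]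
      linear_combination hc / 2
    refine ⟨w, fun P => le_max_left _ _, fun i j => ?_⟩
    by_cases hij : i = j
    · subst hij
      simp [hdiag, cutSemimetric]
    · rw [sum_mul_cutSemimetric w hij, hsum, hsum, hw i j hij]
      ring
end

section
/- For n ≥ 3 and m = C(n,2), the matrix S_r := (1/2^{n−2})·Sᵀ·(I_m − (1/(m+1))·J_m) is a right inverse of the full cut-matrix S, i.e. S·S_r = I_m. -/
open Finset Matrix

/-- The 2-element subsets of `V_n = Fin n`; there are `C(n,2)` of them. -/
abbrev Pairs (n : ℕ) := {P : Finset (Fin n) // P.card = 2}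

/-- The nontrivial cuts of `V_n = Fin n`: subsets `C` with `∅ ⊊ C ⊊ V_n`;
there are `2^n − 2` of them. -/
abbrev Cuts (n : ℕ) := {C : Finset (Fin n) // C ≠ ∅ ∧ C ≠ Finset.univ}

/-- The full cut-matrix `S`: rows indexed by the 2-element subsets `{i,j}` of `V_n`,
columns indexed by the nontrivial cuts `C`, with entry `δ_C(i,j)`, i.e. 1 iff
`|{i,j} ∩ C| = 1` (exactly one of `i, j` lies in `C`). -/
def fullCutMatrix (n : ℕ) : Matrix (Pairs n) (Cuts n) ℝ :=
  Matrix.of fun P C => if (P.1 ∩ C.1).card = 1 then 1 else 0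

/-- The Walsh function of `P`: the character `C ↦ (-1) ^ |P ∩ C|` of the power set. -/
def walsh {ι : Type*} [DecidableEq ι] (P C : Finset ι) : ℝ :=
  ∏ i ∈ C, if i ∈ P then -1 else 1

lemma walsh_eq_neg_one_pow {ι : Type*} [DecidableEq ι] (P C : Finset ι) :
    walsh P C = (-1) ^ (P ∩ C).card := by
  rw [walsh, Finset.prod_ite, Finset.prod_const_one, mul_one, Finset.prod_const,
    Finset.filter_mem_eq_inter, Finset.inter_comm]

lemma sum_walsh_eq_zero {ι : Type*} [DecidableEq ι] [Fintype ι] {P : Finset ι}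
    (hP : P.Nonempty) : ∑ C, walsh P C = 0 := by
  obtain ⟨i, hi⟩ := hP
  simp only [walsh]
  rw [← Finset.powerset_univ, ← Finset.prod_one_add]
  exact Finset.prod_eq_zero (Finset.mem_univ i) (by simp [hi])

lemma sum_walsh_mul_walsh {ι : Type*} [DecidableEq ι] [Fintype ι] (P Q : Finset ι) :
    ∑ C, walsh P C * walsh Q C = if P = Q then 2 ^ Fintype.card ι else 0 := by
  simp only [walsh, ← Finset.prod_mul_distrib]
  rw [← Finset.powerset_univ, ← Finset.prod_one_add]
  split_ifs with h
  · subst h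
    rw [← Finset.card_univ, ← Finset.prod_const]
    refine Finset.prod_congr rfl fun i _ => ?_
    split_ifs <;> norm_num
  · obtain ⟨i, hi⟩ : ∃ i, ¬(i ∈ P ↔ i ∈ Q) := by
      by_contra! hc
      exact h (Finset.ext hc)
    refine Finset.prod_eq_zero (Finset.mem_univ i) ?_
    by_cases hp : i ∈ P <;> by_cases hq : i ∈ Q <;> simp_all

lemma ite_card_inter_eq_walsh {ι : Type*} [DecidableEq ι] {P : Finset ι} (hP : P.card = 2)
    (C : Finset ι) : (if (P ∩ C).card = 1 then (1 : ℝ) else 0) = (1 - walsh P C) / 2 := by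
  have h : (P ∩ C).card ≤ 2 := hP ▸ Finset.card_le_card Finset.inter_subset_left
  rw [walsh_eq_neg_one_pow]
  interval_cases (P ∩ C).card <;> norm_num

/-- Extending the sum over nontrivial cuts to all cuts adds only vanishing terms. -/
lemma fullCutMatrix_mul_transpose_apply_eq_sum (n : ℕ) (P Q : Pairs n) :
    (fullCutMatrix n * (fullCutMatrix n)ᵀ) P Q =
      ∑ C : Finset (Fin n), (1 - walsh P.1 C) / 2 * ((1 - walsh Q.1 C) / 2) := by
  simp only [← ite_card_inter_eq_walsh P.2, ← ite_card_inter_eq_walsh Q.2, Matrix.mul_apply,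
    Matrix.transpose_apply, fullCutMatrix, Matrix.of_apply]
  rw [← Finset.sum_subtype (Finset.univ.filter fun C : Finset (Fin n) => C ≠ ∅ ∧ C ≠ Finset.univ)
    (by simp) fun C : Finset (Fin n) => (if (P.1 ∩ C).card = 1 then (1 : ℝ) else 0) *
      if (Q.1 ∩ C).card = 1 then 1 else 0]
  refine Finset.sum_subset (Finset.filter_subset _ _) fun C _ hC => ?_
  have hC' : C = ∅ ∨ C = Finset.univ := by
    by_contra h
    exact hC (Finset.mem_filter.mpr ⟨Finset.mem_univ C, not_or.mp h⟩)
  obtain rfl | rfl := hC' <;> simp [P.2]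

/-- The Gram matrix of the rows of the full cut-matrix is `2 ^ (n - 2) • (I + J)`. -/
lemma fullCutMatrix_mul_transpose (n : ℕ) (hn : 2 ≤ n) :
    fullCutMatrix n * (fullCutMatrix n)ᵀ =
      (2 ^ (n - 2) : ℝ) • (1 + Matrix.of fun _ _ : Pairs n => (1 : ℝ)) := by
  ext P Q
  have hne (R : Pairs n) : R.1.Nonempty := Finset.card_pos.mp (by rw [R.2]; norm_num)
  have hexpand (C : Finset (Fin n)) : (1 - walsh P.1 C) / 2 * ((1 - walsh Q.1 C) / 2) =
      (1 - walsh P.1 C - walsh Q.1 C + walsh P.1 C * walsh Q.1 C) / 4 := by ring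
  have hpow : (2 : ℝ) ^ n = 2 ^ (n - 2) * 4 := by
    rw [show (4 : ℝ) = 2 ^ 2 by norm_num, ← pow_add, Nat.sub_add_cancel hn]
  rw [fullCutMatrix_mul_transpose_apply_eq_sum]
  simp only [hexpand]
  rw [← Finset.sum_div, Finset.sum_add_distrib, Finset.sum_sub_distrib, Finset.sum_sub_distrib,
    sum_walsh_eq_zero (hne P), sum_walsh_eq_zero (hne Q), sum_walsh_mul_walsh]
  simp only [Finset.sum_const, Finset.card_univ, Fintype.card_finset, Fintype.card_fin,
    nsmul_eq_mul, Nat.cast_pow, Nat.cast_ofNat, hpow, Matrix.smul_apply, Matrix.add_apply,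
    Matrix.one_apply, Matrix.of_apply, smul_eq_mul, Subtype.ext_iff]
  split_ifs <;> ring

lemma allOnes_mul_allOnes {ι : Type*} [Fintype ι] :
    (Matrix.of fun _ _ : ι => (1 : ℝ)) * Matrix.of (fun _ _ : ι => (1 : ℝ)) =
      (Fintype.card ι : ℝ) • Matrix.of fun _ _ : ι => (1 : ℝ) := by
  ext i j
  simp [Matrix.mul_apply]

lemma card_pairs (n : ℕ) : Fintype.card (Pairs n) = n.choose 2 := by
  simp

/-- For `n ≥ 3` and `m = C(n,2)`, the matrix
`S_r = (1/2^{n−2})·Sᵀ·(I_m − (1/(m+1))·J_m)` is a right inverse of the full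
cut-matrix `S`: `S·S_r = I_m`. -/
theorem fullCutMatrix_right_inverse (n : ℕ) (hn : 3 ≤ n) :
    fullCutMatrix n *
        ((2 ^ (n - 2) : ℝ)⁻¹ •
          ((fullCutMatrix n)ᵀ *
            (1 - ((n.choose 2 : ℝ) + 1)⁻¹ • Matrix.of (fun _ _ : Pairs n => (1 : ℝ))))) =
      1 := by
  have hm : (n.choose 2 : ℝ) + 1 ≠ 0 := by positivity
  rw [Matrix.mul_smul, ← Matrix.mul_assoc, fullCutMatrix_mul_transpose n (by omega),
    Matrix.smul_mul, smul_smul, inv_mul_cancel₀ (by positivity), one_smul, add_mul, one_mul,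
    mul_sub, mul_one, Matrix.mul_smul, allOnes_mul_allOnes, card_pairs]
  ext P Q
  simp only [Matrix.add_apply, Matrix.sub_apply, Matrix.smul_apply, Matrix.of_apply, smul_eq_mul]
  field_simp
  ring
end

section
/- Let n ≥ 5. The family B_n consisting of the vectors ψ_T for all subsets T ⊆ V_n with 3 ≤ |T| ≤ n, together with the vectors φ_k = e_{{k}} − e_{V_n∖{k}} for k = 1, …, n − 1, is a basis of the kernel of the full cut-matrix S: all these vectors lie in Ker(S), they are linearly independent, and their number, (2^n − 1 − C(n,2) − n) + (n − 1) = 2^n − 2 − C(n,2), equals the dimension of Ker(S). -/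
open Finset Matrix

/-- The standard-basis vector of `ℝ^{2^n−2}` corresponding to the cut `D` (zero if
`D` is not a nontrivial cut). -/
def stdBasisCut {n : ℕ} (D : Finset (Fin n)) : Cuts n → ℝ :=
  fun C => if C.1 = D then 1 else 0

/-- The alternating-sum vector `ψ_T = ∑_{C ⊆ T, C nontrivial} (−1)^{|C|}·e_C`. -/
def psiVec {n : ℕ} (T : Finset (Fin n)) : Cuts n → ℝ :=
  fun C => if C.1 ⊆ T then (-1 : ℝ) ^ C.1.card else 0

/-- The skew-symmetric kernel vector `φ_k = e_{{k}} − e_{V_n∖{k}}`. -/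
def phiSingle {n : ℕ} (k : Fin n) : Cuts n → ℝ :=
  fun C => stdBasisCut {k} C - stdBasisCut ({k}ᶜ : Finset (Fin n)) C

/-- The index type of the family `B_n`: subsets `T ⊆ V_n` with `|T| ≥ 3`, together
with the first `n − 1` vertices `k`. -/
abbrev KerIndex (n : ℕ) :=
  {T : Finset (Fin n) // 3 ≤ T.card} ⊕ {k : Fin n // (k : ℕ) < n - 1}

/-- The family `B_n`, consisting of the vectors `ψ_T` for `3 ≤ |T| ≤ n` and the
vectors `φ_k = e_{{k}} − e_{V_n∖{k}}` for `k = 1, …, n − 1`. -/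
def kerFamily (n : ℕ) : KerIndex n → (Cuts n → ℝ) :=
  fun idx => match idx with
    | .inl T => psiVec T.1
    | .inr k => phiSingle k.1

/-- A function on finsets that changes sign when a fixed element is inserted sums to zero. -/
theorem sum_eq_zero_of_insert_eq_neg {α : Type*} [Fintype α] [DecidableEq α] (t : α)
    (f : Finset α → ℝ) (h : ∀ C, t ∉ C → f (insert t C) = -f C) : ∑ C, f C = 0 := by
  have hneg : ∀ C, f (symmDiff C {t}) = -f C := by
    intro C
    by_cases ht : t ∈ C
    · have hC : symmDiff C {t} = C.erase t := by
        ext x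
        simp only [Finset.mem_symmDiff, Finset.mem_singleton, Finset.mem_erase]
        grind
      rw [hC, ← neg_eq_iff_eq_neg, ← h _ (Finset.notMem_erase t C), Finset.insert_erase ht]
    · have hC : symmDiff C {t} = insert t C := by
        ext x
        simp only [Finset.mem_symmDiff, Finset.mem_singleton, Finset.mem_insert]
        grind
      rw [hC, h C ht]
  have hsum := Equiv.sum_comp (symmDiff_left_involutive ({t} : Finset α)).toPerm f
  simp only [Function.Involutive.coe_toPerm, hneg, Finset.sum_neg_distrib] at hsum
  linarith

theorem sum_neg_one_pow_card_between {α : Type*} [Fintype α] [DecidableEq α] (U T : Finset α) :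
    (∑ C : Finset α, if U ⊆ C ∧ C ⊆ T then (-1 : ℝ) ^ C.card else 0) =
      if T = U then (-1) ^ U.card else 0 := by
  split_ifs with hTU
  · subst hTU
    rw [Finset.sum_eq_single T]
    · simp
    · intro C _ hC
      exact if_neg fun h => hC (h.2.antisymm h.1)
    · simp
  · by_cases hsub : U ⊆ T
    · obtain ⟨t, htT, htU⟩ := Finset.exists_of_ssubset (hsub.ssubset_of_ne (Ne.symm hTU))
      refine sum_eq_zero_of_insert_eq_neg t _ fun C ht => ?_
      have h₁ : U ⊆ insert t C ↔ U ⊆ C := Finset.subset_insert_iff_of_notMem htU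
      have h₂ : insert t C ⊆ T ↔ C ⊆ T := by simp [Finset.insert_subset_iff, htT]
      simp only [h₁, h₂, Finset.card_insert_of_notMem ht, pow_succ]
      split_ifs <;> ring
    · exact Finset.sum_eq_zero fun C _ => if_neg fun h => hsub (h.1.trans h.2)

/-- Möbius inversion over supersets. -/
theorem sum_superset_sum_superset {α : Type*} [Fintype α] [DecidableEq α]
    (a : Finset α → ℝ) (U : Finset α) :
    (∑ C : Finset α, if U ⊆ C then (-1) ^ C.card * ∑ T, (if C ⊆ T then a T else 0) else 0) =
      (-1) ^ U.card * a U := by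
  calc
    _ = ∑ C : Finset α, ∑ T, a T * (if U ⊆ C ∧ C ⊆ T then (-1 : ℝ) ^ C.card else 0) := by
      refine Finset.sum_congr rfl fun C _ => ?_
      by_cases hUC : U ⊆ C
      · simp only [hUC, if_true, true_and, Finset.mul_sum]
        refine Finset.sum_congr rfl fun T _ => ?_
        split_ifs <;> ring
      · simp [hUC]
    _ = ∑ T, a T * (if T = U then (-1) ^ U.card else 0) := by
      rw [Finset.sum_comm]
      simp only [← Finset.mul_sum, sum_neg_one_pow_card_between]
    _ = _ := by simp [mul_comm]

theorem sum_cuts {n : ℕ} (f : Finset (Fin n) → ℝ) (h₀ : f ∅ = 0) (h₁ : f Finset.univ = 0) :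
    ∑ C : Cuts n, f C.1 = ∑ C, f C := by
  rw [← Finset.sum_subset (Finset.subset_univ
    (Finset.univ.filter fun C : Finset (Fin n) => C ≠ ∅ ∧ C ≠ Finset.univ))]
  · exact (Finset.sum_subtype _ (by simp) f).symm
  · intro C _ hC
    by_cases hC₀ : C = ∅
    · rw [hC₀, h₀]
    · have hC₁ : C = Finset.univ := by simpa [hC₀] using hC
      rw [hC₁, h₁]

theorem fullCutMatrix_mulVec_psiVec {n : ℕ} (T : Finset (Fin n)) (hT : 3 ≤ T.card) :
    (fullCutMatrix n).mulVec (psiVec T) = 0 := by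
  ext P
  obtain ⟨t, htT, htP⟩ : ∃ t ∈ T, t ∉ P.1 :=
    Finset.exists_mem_notMem_of_card_lt_card (by rw [P.2]; omega)
  simp only [Matrix.mulVec, dotProduct, fullCutMatrix, psiVec, Matrix.of_apply, Pi.zero_apply]
  rw [sum_cuts (fun C => (if (P.1 ∩ C).card = 1 then (1 : ℝ) else 0) *
    (if C ⊆ T then (-1) ^ C.card else 0)) (by simp) (by simp [P.2])]
  refine sum_eq_zero_of_insert_eq_neg t _ fun C ht => ?_
  have h₂ : insert t C ⊆ T ↔ C ⊆ T := by simp [Finset.insert_subset_iff, htT]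
  simp only [h₂, Finset.inter_insert_of_notMem htP, Finset.card_insert_of_notMem ht, pow_succ]
  split_ifs <;> ring

theorem fullCutMatrix_mulVec_stdBasisCut {n : ℕ} (D : Cuts n) (P : Pairs n) :
    (fullCutMatrix n).mulVec (stdBasisCut D.1) P = if (P.1 ∩ D.1).card = 1 then 1 else 0 := by
  simp only [Matrix.mulVec, dotProduct, fullCutMatrix, stdBasisCut, Matrix.of_apply,
    Subtype.coe_inj]
  simp

theorem fullCutMatrix_mulVec_phiSingle {n : ℕ} (hn : 2 ≤ n) (k : Fin n) :
    (fullCutMatrix n).mulVec (phiSingle k) = 0 := by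
  have hk : ({k} : Finset (Fin n)) ≠ Finset.univ := fun h => by
    have := congrArg Finset.card h
    simp at this; omega
  ext P
  have hphi : (phiSingle k : Cuts n → ℝ) = stdBasisCut {k} - stdBasisCut ({k}ᶜ) := rfl
  have h₁ := fullCutMatrix_mulVec_stdBasisCut ⟨{k}, by simp, hk⟩ P
  have h₂ := fullCutMatrix_mulVec_stdBasisCut ⟨{k}ᶜ, by simpa using hk, by simp⟩ P
  have hcard := Finset.card_inter_add_card_sdiff P.1 {k}
  rw [P.2, Finset.sdiff_eq_inter_compl] at hcard
  rw [hphi, Matrix.mulVec_sub, Pi.sub_apply, h₁, h₂, Pi.zero_apply, sub_eq_zero]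
  exact if_congr (by dsimp only; omega) rfl rfl

theorem linearIndependent_kerFamily {n : ℕ} (hn : 3 ≤ n) :
    LinearIndependent ℝ (kerFamily n) := by
  rw [Fintype.linearIndependent_iff]
  intro g hg
  let a : Finset (Fin n) → ℝ := fun T => if h : 3 ≤ T.card then g (.inl ⟨T, h⟩) else 0
  let b : Fin n → ℝ := fun k => if h : (k : ℕ) < n - 1 then g (.inr ⟨k, h⟩) else 0
  let G : Finset (Fin n) → ℝ := fun C => (-1) ^ C.card * ∑ T, (if C ⊆ T then a T else 0)
  have hcut : ∀ C : Cuts n, G C.1 +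
      ∑ k, b k * ((if C.1 = {k} then 1 else 0) - (if C.1 = {k}ᶜ then 1 else 0)) = 0 := by
    intro C
    refine Eq.trans ?_ (congrFun hg C)
    rw [Fintype.sum_sum_type, Pi.add_apply, Finset.sum_apply, Finset.sum_apply]
    congr 1
    · simp only [G, Finset.mul_sum]
      rw [← Finset.sum_subset (Finset.subset_univ
        (Finset.univ.filter fun T : Finset (Fin n) => 3 ≤ T.card))]
      · rw [Finset.sum_subtype (p := fun T : Finset (Fin n) => 3 ≤ T.card) _ (by simp)]
        refine Finset.sum_congr rfl fun T _ => ?_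
        simp [a, T.2, kerFamily, psiVec, mul_comm]
      · intro T _ hT
        simp at hT
        simp [a, hT]
    · rw [← Finset.sum_subset (Finset.subset_univ
        (Finset.univ.filter fun k : Fin n => (k : ℕ) < n - 1))]
      · rw [Finset.sum_subtype (p := fun k : Fin n => (k : ℕ) < n - 1) _ (by simp)]
        refine Finset.sum_congr rfl fun k _ => ?_
        simp [b, k.2, kerFamily, phiSingle, stdBasisCut]
      · intro k _ hk
        simp only [Finset.mem_filter, Finset.mem_univ, true_and] at hk
        simp [b, hk]
  have hG : ∀ C : Finset (Fin n), 2 ≤ C.card →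
      G C = (if C = Finset.univ then G Finset.univ else 0) +
        ∑ k, b k * (if C = {k}ᶜ then 1 else 0) := by
    intro C hC
    by_cases hu : C = Finset.univ
    · subst hu
      have : ∀ k : Fin n, (Finset.univ : Finset (Fin n)) ≠ {k}ᶜ := fun k h => by
        simpa using h.symm
      simp [this]
    · have hs : ∀ k : Fin n, C ≠ {k} := fun k h => by simp [h] at hC
      have h0 : C ≠ ∅ := fun h => by simp [h] at hC
      have := hcut ⟨C, h0, hu⟩
      simp only [hs, if_false, zero_sub, mul_neg, Finset.sum_neg_distrib] at this
      simp only [hu, if_false]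
      linarith
  have hinv : ∀ U : Finset (Fin n), 2 ≤ U.card →
      (-1) ^ U.card * a U = G Finset.univ + ∑ k, if k ∈ U then 0 else b k := by
    intro U hU
    rw [← sum_superset_sum_superset]
    calc
      _ = ∑ C, if U ⊆ C then G C else 0 := rfl
      _ = ∑ C, ((if C = Finset.univ then G Finset.univ else 0) +
            ∑ k, if C = {k}ᶜ then (if k ∈ U then 0 else b k) else 0) := by
        refine Finset.sum_congr rfl fun C _ => ?_
        by_cases hUC : U ⊆ C
        · rw [if_pos hUC, hG C (hU.trans (Finset.card_le_card hUC))]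
          congr 1
          refine Finset.sum_congr rfl fun k _ => ?_
          split_ifs with h₁ h₂
          · subst h₁
            simpa using hUC h₂
          · simp
          · simp
        · have hu : C ≠ Finset.univ := fun h => hUC (h ▸ Finset.subset_univ U)
          rw [if_neg hUC, if_neg hu, zero_add]
          refine (Finset.sum_eq_zero fun k _ => ?_).symm
          split_ifs with h₁ h₂
          · rfl
          · subst h₁
            exact absurd (Finset.subset_compl_comm.1 (by simpa using h₂)) hUC
          · rfl
      _ = _ := by
        rw [Finset.sum_add_distrib, Finset.sum_comm]
        simp
  have hpair : ∀ i j : Fin n, i ≠ j → b i + b j = G Finset.univ + ∑ k, b k := by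
    intro i j hij
    have h₁ := hinv {i, j} (by rw [Finset.card_pair hij])
    have h₂ : a {i, j} = 0 := by simp [a, Finset.card_pair hij]
    have h₃ : (∑ k, if k ∈ ({i, j} : Finset (Fin n)) then 0 else b k) =
        ∑ k, b k - (b i + b j) := by
      rw [← Finset.sum_pair hij, eq_sub_iff_add_eq, ← Finset.sum_ite_mem_eq {i, j} b,
        ← Finset.sum_add_distrib]
      exact Finset.sum_congr rfl fun k _ => by split_ifs <;> simp
    rw [h₂, h₃] at h₁
    linarith
  have hlast : b ⟨n - 1, by omega⟩ = 0 := by simp [b]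
  have hb : ∀ i, b i = 0 := by
    intro i
    by_cases hi : i = ⟨n - 1, by omega⟩
    · rw [hi, hlast]
    · have hlt : ({i, ⟨n - 1, by omega⟩} : Finset (Fin n)).card <
          (Finset.univ : Finset (Fin n)).card := by
        rw [Finset.card_pair hi, Finset.card_univ, Fintype.card_fin]
        exact hn
      obtain ⟨l, -, hl⟩ := Finset.exists_mem_notMem_of_card_lt_card hlt
      simp only [Finset.mem_insert, Finset.mem_singleton, not_or] at hl
      linarith [hpair i l (Ne.symm hl.1), hpair _ l (Ne.symm hl.2)]
  have huniv : G Finset.univ = 0 := by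
    have := hpair ⟨0, by omega⟩ ⟨1, by omega⟩ (by simp)
    simpa [hb] using this.symm
  rintro (⟨T, hT⟩ | ⟨k, hk⟩)
  · have := hinv T (by omega)
    simp [hb, huniv] at this
    simpa [a, hT] using this
  · simpa [b, hk] using hb k

theorem card_cuts {n : ℕ} (hn : 1 ≤ n) : Fintype.card (Cuts n) + 2 = 2 ^ n := by
  have hne : (∅ : Finset (Fin n)) ≠ Finset.univ := fun h => by
    have := congrArg Finset.card h
    simp at this; omega
  have hpair : ((Finset.univ : Finset (Finset (Fin n))).filter
      fun C => ¬ (C ≠ ∅ ∧ C ≠ Finset.univ)).card = 2 := by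
    rw [← Finset.card_pair hne]
    congr 1
    ext C
    simp only [Finset.mem_filter, Finset.mem_univ, true_and, Finset.mem_insert,
      Finset.mem_singleton]
    tauto
  have h := Finset.card_filter_add_card_filter_not (s := (Finset.univ : Finset (Finset (Fin n))))
    fun C => C ≠ ∅ ∧ C ≠ Finset.univ
  rw [hpair, Finset.card_univ, Fintype.card_finset, Fintype.card_fin] at h
  rwa [Fintype.card_subtype]

theorem card_three_le_card (n : ℕ) :
    Fintype.card {T : Finset (Fin n) // 3 ≤ T.card} + (1 + n + n.choose 2) = 2 ^ n := by
  have hlt : ((Finset.univ : Finset (Finset (Fin n))).filter fun T => ¬ 3 ≤ T.card).card =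
      1 + n + n.choose 2 := by
    rw [Finset.card_eq_sum_card_fiberwise (f := Finset.card) (t := Finset.range 3)
      (by intro T hT; simpa using hT)]
    have : ∀ m ∈ Finset.range 3, (((Finset.univ : Finset (Finset (Fin n))).filter
        fun T => ¬ 3 ≤ T.card).filter fun T => T.card = m).card = n.choose m := by
      intro m hm
      have h := Finset.card_powersetCard m (Finset.univ : Finset (Fin n))
      rw [Finset.card_univ, Fintype.card_fin] at h
      rw [← h]
      congr 1
      ext T
      simp at hm ⊢
      omega
    rw [Finset.sum_congr rfl this]
    simp [Finset.sum_range_succ]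
  rw [Fintype.card_subtype, ← hlt, Finset.card_filter_add_card_filter_not]
  simp

theorem card_kerIndex {n : ℕ} (hn : 1 ≤ n) :
    Fintype.card (KerIndex n) + n.choose 2 + 2 = 2 ^ n := by
  have hk : Fintype.card {k : Fin n // (k : ℕ) < n - 1} = n - 1 := by
    rw [Fintype.card_subtype, Fin.card_filter_val_lt]
    omega
  have := card_three_le_card n
  rw [Fintype.card_sum, hk]
  omega

theorem fullCutMatrix_mulVecLin_surjective {n : ℕ} (hn : 3 ≤ n) :
    Function.Surjective (fullCutMatrix n).mulVecLin := by
  rw [← LinearMap.range_eq_top, eq_top_iff, ← (Pi.basisFun ℝ (Pairs n)).span_eq,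
    Submodule.span_le]
  rintro _ ⟨⟨Q, hQ⟩, rfl⟩
  obtain ⟨i, j, hij, rfl⟩ := Finset.card_eq_two.1 hQ
  have hcut : ∀ D : Finset (Fin n), D.Nonempty → D.card ≤ 2 → D ≠ ∅ ∧ D ≠ Finset.univ :=
    fun D h₁ h₂ => ⟨h₁.ne_empty, fun h => by simp [h] at h₂; omega⟩
  let Di : Cuts n := ⟨{i}, hcut _ (by simp) (by simp)⟩
  let Dj : Cuts n := ⟨{j}, hcut _ (by simp) (by simp)⟩
  let Dij : Cuts n := ⟨{i, j}, hcut _ (by simp) hQ.le⟩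
  refine ⟨(1 / 2 : ℝ) • (stdBasisCut Di.1 + stdBasisCut Dj.1 - stdBasisCut Dij.1), ?_⟩
  ext ⟨P, hP⟩
  rw [map_smul, map_sub, map_add]
  simp only [Matrix.mulVecLin_apply, Pi.smul_apply, Pi.sub_apply, Pi.add_apply,
    fullCutMatrix_mulVec_stdBasisCut, Pi.basisFun_apply, Pi.single_apply, Subtype.mk.injEq]
  simp only [Di, Dj, Dij]
  have hpair : P = {i, j} ↔ i ∈ P ∧ j ∈ P := by
    constructor
    · rintro rfl; simp
    · rintro ⟨hi, hj⟩
      exact (Finset.eq_of_subset_of_card_le (by simp [Finset.insert_subset_iff, hi, hj])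
        (by rw [hP, hQ])).symm
  simp only [hpair]
  by_cases hi : i ∈ P <;> by_cases hj : j ∈ P <;>
    norm_num [hi, hj, hij, Finset.inter_insert_of_mem, Finset.inter_insert_of_notMem]

/-- For `n ≥ 5`, the family `B_n` (the vectors `ψ_T` for
`3 ≤ |T| ≤ n` together with `φ_k = e_{{k}} − e_{V_n∖{k}}` for `k = 1, …, n−1`) is a
basis of `Ker(S)`: all its vectors lie in the kernel of the full cut-matrix `S`, they
are linearly independent, and their number,
`(2^n − 1 − C(n,2) − n) + (n − 1) = 2^n − 2 − C(n,2)`, equals `dim Ker(S)`. -/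
theorem kernel_basis_of_fullCutMatrix (n : ℕ) (hn : 5 ≤ n) :
    (∀ idx : KerIndex n, (fullCutMatrix n).mulVec (kerFamily n idx) = 0) ∧
    LinearIndependent ℝ (kerFamily n) ∧
    Fintype.card (KerIndex n) = 2 ^ n - 2 - n.choose 2 ∧
    Fintype.card (KerIndex n) =
      Module.finrank ℝ (LinearMap.ker (fullCutMatrix n).mulVecLin) := by
  have hcard := card_kerIndex (n := n) (by omega)
  refine ⟨?_, linearIndependent_kerFamily (by omega), by omega, ?_⟩
  · rintro (T | k)
    · exact fullCutMatrix_mulVec_psiVec T.1 T.2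
    · exact fullCutMatrix_mulVec_phiSingle (by omega) k.1
  · have hrank := (fullCutMatrix n).mulVecLin.finrank_range_add_finrank_ker
    rw [LinearMap.range_eq_top.2 (fullCutMatrix_mulVecLin_surjective (by omega)), finrank_top,
      Module.finrank_fintype_fun_eq_card, Module.finrank_fintype_fun_eq_card,
      Fintype.card_finset_len, Fintype.card_fin] at hrank
    have := card_cuts (n := n) (by omega)
    omega
end
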